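/- Let c > 1, θ ∈ ℝ, and a, b ∈ ℝ with b² ≠ a². Set ω = (a²+b²)/((b²−a²)·√(c²−1)), t(x,y) = ay−bx, and Ω = {(x,y) ∈ ℝ² : cosh²θ·sin²(ω·t(x,y)) < 1}. On Ω (where in particular cos(ωt) ≠ 0 and |sinhθ·tan(ωt)| < 1, so all formulas are well defined) define R(x,y) = arccos(coshθ·sin(ω·t)) and S(x,y) = ax + by + (2ab/(b²−a²))·t + arctanh(sinhθ·tan(ω·t)). Let A(r) = c²·sin²r + cos²r and B(r) = sin²r. Then on Ω: 2A(R)(R_xx−R_yy) + A'(R)(R_x²−R_y²) + B'(R)(S_x²−S_y²) = 0 and B(R)(S_xx−S_yy) + B'(R)(R_x·S_x−R_y·S_y) = 0. -/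

import Mathlib

open Real

/-- First partial derivative in the `x` direction. -/
noncomputable def px (f : ℝ × ℝ → ℝ) (p : ℝ × ℝ) : ℝ := fderiv ℝ f p (1, 0)

/-- First partial derivative in the `y` direction. -/
noncomputable def py (f : ℝ × ℝ → ℝ) (p : ℝ × ℝ) : ℝ := fderiv ℝ f p (0, 1)

/-- The inverse hyperbolic tangent, `arctanh x = (1/2) log ((1+x)/(1-x))`. -/
noncomputable def arctanh (x : ℝ) : ℝ := Real.log ((1 + x) / (1 - x)) / 2

open Filter Topology

theorem hasFDerivAt_linear_add_comp {f : ℝ → ℝ} {f' a b : ℝ} (α β : ℝ) {p : ℝ × ℝ}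
    (hf : HasDerivAt f f' (a * p.2 - b * p.1)) :
    HasFDerivAt (fun p : ℝ × ℝ => α * p.1 + β * p.2 + f (a * p.2 - b * p.1))
      (α • ContinuousLinearMap.fst ℝ ℝ ℝ + β • ContinuousLinearMap.snd ℝ ℝ ℝ
        + f' • (a • ContinuousLinearMap.snd ℝ ℝ ℝ - b • ContinuousLinearMap.fst ℝ ℝ ℝ)) p := by
  have h1 : HasFDerivAt (fun p : ℝ × ℝ => p.1) (ContinuousLinearMap.fst ℝ ℝ ℝ) p := hasFDerivAt_fst
  have h2 : HasFDerivAt (fun p : ℝ × ℝ => p.2) (ContinuousLinearMap.snd ℝ ℝ ℝ) p := hasFDerivAt_snd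
  exact ((h1.const_mul α).add (h2.const_mul β)).add
    (hf.comp_hasFDerivAt p ((h2.const_mul a).sub (h1.const_mul b)))

theorem px_linear_add_comp {f : ℝ → ℝ} {f' a b : ℝ} (α β : ℝ) {p : ℝ × ℝ}
    (hf : HasDerivAt f f' (a * p.2 - b * p.1)) :
    px (fun p : ℝ × ℝ => α * p.1 + β * p.2 + f (a * p.2 - b * p.1)) p = α - b * f' := by
  rw [px, (hasFDerivAt_linear_add_comp α β hf).fderiv]
  simp
  ring

theorem py_linear_add_comp {f : ℝ → ℝ} {f' a b : ℝ} (α β : ℝ) {p : ℝ × ℝ}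
    (hf : HasDerivAt f f' (a * p.2 - b * p.1)) :
    py (fun p : ℝ × ℝ => α * p.1 + β * p.2 + f (a * p.2 - b * p.1)) p = β + a * f' := by
  rw [py, (hasFDerivAt_linear_add_comp α β hf).fderiv]
  simp
  ring

theorem eventually_comp_linear {P : ℝ → Prop} {a b : ℝ} {p : ℝ × ℝ}
    (h : ∀ᶠ u in 𝓝 (a * p.2 - b * p.1), P u) :
    ∀ᶠ q : ℝ × ℝ in 𝓝 p, P (a * q.2 - b * q.1) :=
  (show Continuous fun q : ℝ × ℝ => a * q.2 - b * q.1 by fun_prop).continuousAt.eventually h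

theorem px_px_linear_add_comp {f f' : ℝ → ℝ} {f'' a b : ℝ} (α β : ℝ) {p : ℝ × ℝ}
    (hf : ∀ᶠ u in 𝓝 (a * p.2 - b * p.1), HasDerivAt f (f' u) u)
    (hf' : HasDerivAt f' f'' (a * p.2 - b * p.1)) :
    px (px fun p : ℝ × ℝ => α * p.1 + β * p.2 + f (a * p.2 - b * p.1)) p = b ^ 2 * f'' := by
  have h : px (fun p : ℝ × ℝ => α * p.1 + β * p.2 + f (a * p.2 - b * p.1)) =ᶠ[𝓝 p]
      fun q => 0 * q.1 + 0 * q.2 + (fun u => α - b * f' u) (a * q.2 - b * q.1) :=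
    (eventually_comp_linear hf).mono fun q hq => by
      simpa using px_linear_add_comp α β hq
  rw [px, h.fderiv_eq]
  refine (px_linear_add_comp 0 0 ((hf'.const_mul b).const_sub α)).trans ?_
  ring

theorem py_py_linear_add_comp {f f' : ℝ → ℝ} {f'' a b : ℝ} (α β : ℝ) {p : ℝ × ℝ}
    (hf : ∀ᶠ u in 𝓝 (a * p.2 - b * p.1), HasDerivAt f (f' u) u)
    (hf' : HasDerivAt f' f'' (a * p.2 - b * p.1)) :
    py (py fun p : ℝ × ℝ => α * p.1 + β * p.2 + f (a * p.2 - b * p.1)) p = a ^ 2 * f'' := by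
  have h : py (fun p : ℝ × ℝ => α * p.1 + β * p.2 + f (a * p.2 - b * p.1)) =ᶠ[𝓝 p]
      fun q => 0 * q.1 + 0 * q.2 + (fun u => β + a * f' u) (a * q.2 - b * q.1) :=
    (eventually_comp_linear hf).mono fun q hq => by
      simpa using py_linear_add_comp α β hq
  rw [py, h.fderiv_eq]
  refine (py_linear_add_comp 0 0 ((hf'.const_mul a).const_add β)).trans ?_
  ring

theorem hasDerivAt_arctanh {x : ℝ} (hx : x ^ 2 < 1) :
    HasDerivAt arctanh (1 / (1 - x ^ 2)) x := by
  obtain ⟨h1, h2⟩ := abs_lt.1 ((sq_lt_one_iff_abs_lt_one x).1 hx)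
  have hp : 1 + x ≠ 0 := by linarith
  have hm : 1 - x ≠ 0 := by linarith
  have hx' : 1 - x ^ 2 ≠ 0 := by linarith
  have h := (((((hasDerivAt_id x).const_add 1).div ((hasDerivAt_id x).const_sub 1) hm).log
    (div_ne_zero hp hm)).div_const 2)
  change HasDerivAt (fun x => Real.log ((1 + x) / (1 - x)) / 2) _ x
  refine h.congr_deriv ?_
  simp only [id, Pi.div_apply]
  field_simp
  ring

theorem hasDerivAt_sin_const_mul (ω u : ℝ) :
    HasDerivAt (fun u => sin (ω * u)) (ω * cos (ω * u)) u := by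
  refine ((hasDerivAt_id u).const_mul ω).sin.congr_deriv ?_
  simp
  ring

theorem hasDerivAt_cos_const_mul (ω u : ℝ) :
    HasDerivAt (fun u => cos (ω * u)) (-(ω * sin (ω * u))) u := by
  refine ((hasDerivAt_id u).const_mul ω).cos.congr_deriv ?_
  simp
  ring

theorem hasDerivAt_arccos_mul_sin {C ω u : ℝ} (hu : C ^ 2 * sin (ω * u) ^ 2 < 1) :
    HasDerivAt (fun u => arccos (C * sin (ω * u)))
      (-(C * ω * cos (ω * u)) / √(1 - C ^ 2 * sin (ω * u) ^ 2)) u := by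
  rw [← mul_pow] at hu
  obtain ⟨h1, h2⟩ := abs_lt.1 ((sq_lt_one_iff_abs_lt_one _).1 hu)
  refine ((Real.hasDerivAt_arccos h1.ne' h2.ne).comp u
    ((hasDerivAt_sin_const_mul ω u).const_mul C)).congr_deriv ?_
  rw [mul_pow]
  ring

theorem hasDerivAt_deriv_arccos_mul_sin {C ω u : ℝ} (hu : C ^ 2 * sin (ω * u) ^ 2 < 1) :
    HasDerivAt (fun u => -(C * ω * cos (ω * u)) / √(1 - C ^ 2 * sin (ω * u) ^ 2))
      (C * ω ^ 2 * sin (ω * u) * (1 - C ^ 2) / √(1 - C ^ 2 * sin (ω * u) ^ 2) ^ 3) u := by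
  have hpos : 0 < 1 - C ^ 2 * sin (ω * u) ^ 2 := by linarith
  have hq := (((((hasDerivAt_sin_const_mul ω u).pow 2).const_mul (C ^ 2)).const_sub 1).sqrt
    hpos.ne')
  have h := (((hasDerivAt_cos_const_mul ω u).const_mul (C * ω)).neg).div hq (sqrt_pos.2 hpos).ne'
  refine h.congr_deriv ?_
  have hs := sq_sqrt hpos.le
  have h0 := sqrt_pos.2 hpos
  simp only [Pi.pow_apply, Pi.neg_apply]
  generalize √(1 - C ^ 2 * sin (ω * u) ^ 2) = q at *
  have hc := sin_sq_add_cos_sq (ω * u)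
  field_simp
  push_cast
  have hc' : cos (ω * u) ^ 2 = 1 - sin (ω * u) ^ 2 := by linarith
  ring_nf
  rw [hc', hs]
  ring

theorem cos_ne_zero_of_cosh_mul_sin_lt {θ v : ℝ} (h : cosh θ ^ 2 * sin v ^ 2 < 1) :
    cos v ≠ 0 := by
  intro h0
  have h1 := sin_sq_add_cos_sq v
  have h2 := cosh_sq θ
  nlinarith [sq_nonneg (sinh θ)]

theorem hasDerivAt_arctanh_mul_tan {θ ω u : ℝ} (hu : cosh θ ^ 2 * sin (ω * u) ^ 2 < 1) :
    HasDerivAt (fun u => arctanh (sinh θ * tan (ω * u)))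
      (ω * sinh θ / (1 - cosh θ ^ 2 * sin (ω * u) ^ 2)) u := by
  have hc := cos_ne_zero_of_cosh_mul_sin_lt hu
  have h1 := sin_sq_add_cos_sq (ω * u)
  have h2 := cosh_sq θ
  have hkey : 1 - (sinh θ * tan (ω * u)) ^ 2
      = (1 - cosh θ ^ 2 * sin (ω * u) ^ 2) / cos (ω * u) ^ 2 := by
    rw [tan_eq_sin_div_cos]
    field_simp
    rw [h2]
    linarith
  have hpos : 0 < 1 - cosh θ ^ 2 * sin (ω * u) ^ 2 := by linarith
  have hlt : 0 < 1 - (sinh θ * tan (ω * u)) ^ 2 := by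
    rw [hkey]
    positivity
  have hlin : HasDerivAt (fun u => ω * u) ω u := by
    simpa using (hasDerivAt_id u).const_mul ω
  have htan : HasDerivAt (fun u => sinh θ * tan (ω * u))
      (sinh θ * (1 / cos (ω * u) ^ 2 * ω)) u :=
    ((hasDerivAt_tan hc).comp u hlin).const_mul (sinh θ)
  refine (HasDerivAt.comp u (hasDerivAt_arctanh (by linarith)) htan).congr_deriv ?_
  rw [hkey]
  field_simp

theorem hasDerivAt_deriv_arctanh_mul_tan {C K ω u : ℝ} (hu : C ^ 2 * sin (ω * u) ^ 2 < 1) :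
    HasDerivAt (fun u => K / (1 - C ^ 2 * sin (ω * u) ^ 2))
      (2 * K * C ^ 2 * ω * sin (ω * u) * cos (ω * u) / (1 - C ^ 2 * sin (ω * u) ^ 2) ^ 2) u := by
  have hpos : 1 - C ^ 2 * sin (ω * u) ^ 2 ≠ 0 := by linarith
  have hd := ((((hasDerivAt_sin_const_mul ω u).pow 2).const_mul (C ^ 2)).const_sub 1)
  refine ((hasDerivAt_const u K).div hd hpos).congr_deriv ?_
  simp only [Pi.pow_apply]
  push_cast
  ring

theorem deriv_sin_sq (r : ℝ) : deriv (fun r => sin r ^ 2) r = 2 * sin r * cos r := by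
  refine (((hasDerivAt_sin r).pow 2).congr_deriv ?_).deriv
  simp

theorem deriv_mul_sin_sq_add_cos_sq (k r : ℝ) :
    deriv (fun r => k * sin r ^ 2 + cos r ^ 2) r = 2 * (k - 1) * sin r * cos r := by
  refine (((((hasDerivAt_sin r).pow 2).const_mul k).add
    ((hasDerivAt_cos r).pow 2)).congr_deriv ?_).deriv
  push_cast
  ring

theorem stmt_14 (c θ a b : ℝ) (hc : 1 < c) (hab : b ^ 2 ≠ a ^ 2)
    (ω : ℝ) (hω : ω = (a ^ 2 + b ^ 2) / ((b ^ 2 - a ^ 2) * Real.sqrt (c ^ 2 - 1)))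
    (t : ℝ × ℝ → ℝ) (ht : t = fun p => a * p.2 - b * p.1)
    (Ω : Set (ℝ × ℝ))
    (hΩ : Ω = {p : ℝ × ℝ | Real.cosh θ ^ 2 * Real.sin (ω * t p) ^ 2 < 1})
    (R S : ℝ × ℝ → ℝ)
    (hRdef : R = fun p => Real.arccos (Real.cosh θ * Real.sin (ω * t p)))
    (hSdef : S = fun p => a * p.1 + b * p.2 + (2 * a * b / (b ^ 2 - a ^ 2)) * t p
      + arctanh (Real.sinh θ * Real.tan (ω * t p)))
    (A B : ℝ → ℝ)
    (hAdef : A = fun r => c ^ 2 * Real.sin r ^ 2 + Real.cos r ^ 2)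
    (hBdef : B = fun r => Real.sin r ^ 2) :
    ∀ p ∈ Ω,
      (2 * A (R p) * (px (px R) p - py (py R) p)
          + deriv A (R p) * ((px R p) ^ 2 - (py R p) ^ 2)
          + deriv B (R p) * ((px S p) ^ 2 - (py S p) ^ 2) = 0)
      ∧ (B (R p) * (px (px S) p - py (py S) p)
          + deriv B (R p) * (px R p * px S p - py R p * py S p) = 0) := by
  intro p hp
  have hd : b ^ 2 - a ^ 2 ≠ 0 := sub_ne_zero.2 hab
  have he : 0 < c ^ 2 - 1 := by nlinarith
  obtain ⟨k, hk⟩ : ∃ k, k = 2 * a * b / (b ^ 2 - a ^ 2) := ⟨_, rfl⟩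
  have hkd : k * (b ^ 2 - a ^ 2) = 2 * a * b := by
    rw [hk]
    field_simp
  have hωk : ω ^ 2 * (c ^ 2 - 1) = k ^ 2 + 1 := by
    rw [hω, hk, div_pow, mul_pow, sq_sqrt he.le]
    field_simp
    ring
  rw [← hk] at hSdef
  subst hΩ ht
  have hR : R = fun p : ℝ × ℝ => 0 * p.1 + 0 * p.2
      + (fun u => arccos (cosh θ * sin (ω * u))) (a * p.2 - b * p.1) := by
    rw [hRdef]
    simp
  have hS : S = fun p : ℝ × ℝ => a * p.1 + b * p.2
      + (fun u => k * u + arctanh (sinh θ * tan (ω * u))) (a * p.2 - b * p.1) := by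
    rw [hSdef]
    funext q
    simp only
    ring
  simp only [Set.mem_ofPred_eq] at hp
  have hev : ∀ᶠ u in 𝓝 (a * p.2 - b * p.1), cosh θ ^ 2 * sin (ω * u) ^ 2 < 1 :=
    (show Continuous fun u => cosh θ ^ 2 * sin (ω * u) ^ 2 by fun_prop).continuousAt.eventually_lt
      continuousAt_const hp
  have hRev := hev.mono fun u hu => hasDerivAt_arccos_mul_sin hu
  have hSev : ∀ᶠ u in 𝓝 (a * p.2 - b * p.1),
      HasDerivAt (fun u => k * u + arctanh (sinh θ * tan (ω * u)))
        (k + ω * sinh θ / (1 - cosh θ ^ 2 * sin (ω * u) ^ 2)) u :=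
    hev.mono fun u hu => (((hasDerivAt_id u).const_mul k).add
      (hasDerivAt_arctanh_mul_tan hu)).congr_deriv (by rw [mul_one])
  have hR2 := hasDerivAt_deriv_arccos_mul_sin hp
  have hS2 := (hasDerivAt_deriv_arctanh_mul_tan (K := ω * sinh θ) hp).const_add k
  have hcosR : cos (R p) = cosh θ * sin (ω * (a * p.2 - b * p.1)) := by
    obtain ⟨h1, h2⟩ := abs_lt.1 ((sq_lt_one_iff_abs_lt_one
      (cosh θ * sin (ω * (a * p.2 - b * p.1)))).1 (by rwa [mul_pow]))
    rw [hRdef]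
    exact cos_arccos h1.le h2.le
  have hsinR : sin (R p) = √(1 - cosh θ ^ 2 * sin (ω * (a * p.2 - b * p.1)) ^ 2) := by
    rw [hRdef]
    simp only [sin_arccos, mul_pow]
  rw [hAdef, hBdef, deriv_sin_sq, deriv_mul_sin_sq_add_cos_sq]
  simp only [hcosR, hsinR]
  rw [hR, hS, px_px_linear_add_comp 0 0 hRev hR2, py_py_linear_add_comp 0 0 hRev hR2,
    px_px_linear_add_comp a b hSev hS2, py_py_linear_add_comp a b hSev hS2,
    px_linear_add_comp 0 0 hRev.self_of_nhds, py_linear_add_comp 0 0 hRev.self_of_nhds,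
    px_linear_add_comp a b hSev.self_of_nhds, py_linear_add_comp a b hSev.self_of_nhds]
  have hpos : 0 < 1 - cosh θ ^ 2 * sin (ω * (a * p.2 - b * p.1)) ^ 2 := by linarith
  have hq := sq_sqrt hpos.le
  have hq0 := (sqrt_pos.2 hpos).ne'
  have hsc := sin_sq_add_cos_sq (ω * (a * p.2 - b * p.1))
  have hch := cosh_sq θ
  rw [← hq]
  simp only [sqrt_sq (sqrt_nonneg _)]
  generalize √(1 - cosh θ ^ 2 * sin (ω * (a * p.2 - b * p.1)) ^ 2) = q at *
  generalize sin (ω * (a * p.2 - b * p.1)) = s at *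
  generalize cos (ω * (a * p.2 - b * p.1)) = z at *
  generalize cosh θ = C at *
  generalize sinh θ = H at *
  have hCz : C ^ 2 * z ^ 2 = H ^ 2 + q ^ 2 := by
    linear_combination C ^ 2 * hsc + hch - hq
  have hSS : ∀ h : ℝ, (a - b * (k + h)) ^ 2 - (b + a * (k + h)) ^ 2
      = (b ^ 2 - a ^ 2) * (h ^ 2 - ω ^ 2 * (c ^ 2 - 1)) := fun h => by
    linear_combination (b ^ 2 - a ^ 2) * hωk + 2 * (k + h) * hkd
  have hRS : ∀ g h : ℝ, (0 - b * g) * (a - b * (k + h)) - (0 + a * g) * (b + a * (k + h))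
      = (b ^ 2 - a ^ 2) * (g * h) := fun g h => by
    linear_combination g * hkd
  rw [hSS, hRS]
  constructor
  · have hA : c ^ 2 * q ^ 2 + (C * s) ^ 2 = 1 + (c ^ 2 - 1) * q ^ 2 := by
      linear_combination hq
    have hH : 1 - C ^ 2 = -H ^ 2 := by linear_combination -hch
    rw [hA, hH]
    field_simp
    linear_combination 2 * (c ^ 2 - 1) * q ^ 2 * C * s * ω ^ 2 * (b ^ 2 - a ^ 2) * hCz
  · field_simp
    ring
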